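/- arXiv:2410.10618 — 4 statements merged into one kernel-verified Lean document; each statement's English description precedes it below -/
import Mathlib

section
/- For every n > 0, every integer y ≥ 1, and every β ∈ ℝ, one has (−β + √(β² + 4))^{−y} · exp(−(n/2)(β + √(β² + 4))) = ∫₀^∞ ∫₀^∞ (u^{y−1}/Γ(y)) · exp(−(n/2 − u)β) · (2π)^{−1/2} v^{−3/2} exp(−1/(2v)) · exp(−(v/2)(n/2 + u)² (β² + 4)) dv du. -/
open MeasureTheory Real

/-- The map `x ↦ x - c / x` is a bijection from the positive reals onto the reals. -/
theorem bijOn_sub_div_Ioi {c : ℝ} (hc : 0 < c) :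
    Set.BijOn (fun x : ℝ => x - c / x) (Set.Ioi 0) Set.univ := by
  refine ⟨Set.mapsTo_univ _ _, ?_, ?_⟩
  · intro x hx z hz h
    have hx' : 0 < x := hx
    have hz' : 0 < z := hz
    have h' : x - c / x = z - c / z := h
    have hfac : (x - z) * (x * z + c) = 0 := by
      field_simp at h'
      linear_combination h'
    rcases mul_eq_zero.1 hfac with h0 | h0
    · linarith
    · have : 0 < x * z := mul_pos hx' hz'
      linarith
  · intro t _
    have hs : √(t ^ 2 + 4 * c) ^ 2 = t ^ 2 + 4 * c := sq_sqrt (by positivity)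
    have hlt : -t < √(t ^ 2 + 4 * c) := lt_sqrt_of_sq_lt (by linarith [neg_sq t])
    refine ⟨(t + √(t ^ 2 + 4 * c)) / 2, ?_, ?_⟩
    · simp only [Set.mem_Ioi]
      linarith
    · have hne : t + √(t ^ 2 + 4 * c) ≠ 0 := by linarith
      dsimp only
      field_simp
      linear_combination hs

theorem hasDerivAt_sub_div (c : ℝ) {x : ℝ} (hx : x ≠ 0) :
    HasDerivAt (fun x : ℝ => x - c / x) (1 + c / x ^ 2) x := by
  have h := (hasDerivAt_id x).sub ((hasDerivAt_inv hx).const_mul c)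
  refine h.congr_deriv ?_
  rw [div_eq_mul_inv]
  ring

/-- The Cauchy–Schlömilch substitution applied to the Gaussian integral. -/
theorem integral_exp_neg_half_sub_div_sq {c : ℝ} (hc : 0 < c) :
    ∫ x in Set.Ioi (0 : ℝ), exp (-(1 / 2) * (x - c / x) ^ 2) = √(2 * π) / 2 := by
  set F : ℝ → ℝ := fun x => exp (-(1 / 2) * (x - c / x) ^ 2) with hF
  have hderiv : ∀ x ∈ Set.Ioi (0 : ℝ),
      HasDerivWithinAt (fun x : ℝ => x - c / x) (1 + c / x ^ 2) (Set.Ioi 0) x :=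
    fun x hx => (hasDerivAt_sub_div c (ne_of_gt hx)).hasDerivWithinAt
  have hbij := bijOn_sub_div_Ioi hc
  have habs (x : ℝ) : |1 + c / x ^ 2| • F x = (1 + c / x ^ 2) * F x := by
    rw [abs_of_nonneg (by positivity), smul_eq_mul]
  have hsum : ∫ x in Set.Ioi (0 : ℝ), (1 + c / x ^ 2) * F x = √(2 * π) := by
    have h := integral_image_eq_integral_abs_deriv_smul measurableSet_Ioi hderiv hbij.injOn
      (fun t => exp (-(1 / 2) * t ^ 2))
    rw [hbij.image_eq, Measure.restrict_univ, integral_gaussian] at h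
    rw [← funext habs, ← h]
    congr 1
    ring
  have hsum_int : IntegrableOn (fun x => (1 + c / x ^ 2) * F x) (Set.Ioi 0) := by
    have h := integrableOn_image_iff_integrableOn_abs_deriv_smul measurableSet_Ioi hderiv
      hbij.injOn (fun t => exp (-(1 / 2) * t ^ 2))
    rw [hbij.image_eq, integrableOn_univ] at h
    rw [← funext habs]
    exact h.1 (integrable_exp_neg_mul_sq (by norm_num))
  have hF_int : IntegrableOn F (Set.Ioi 0) := by
    refine hsum_int.mono' (by fun_prop) (.of_forall fun x => ?_)
    have h0 : 0 < F x := exp_pos _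
    rw [norm_of_nonneg h0.le]
    have : 0 ≤ c / x ^ 2 := by positivity
    nlinarith
  have hsymm : ∫ x in Set.Ioi (0 : ℝ), c / x ^ 2 * F x = ∫ x in Set.Ioi (0 : ℝ), F x := by
    have hscale := integral_comp_mul_left_Ioi F 0 hc
    rw [mul_zero, smul_eq_mul, ← integral_comp_rpow_Ioi (fun x => F (c * x))
      (p := -1) (by norm_num)] at hscale
    rw [eq_inv_mul_iff_mul_eq₀ hc.ne', ← integral_const_mul] at hscale
    rw [← hscale]
    refine setIntegral_congr_fun measurableSet_Ioi fun x hx => ?_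
    have hx' : 0 < x := hx
    have hpow : x ^ ((-1 : ℝ) - 1) = (x ^ 2)⁻¹ := by
      rw [show (-1 : ℝ) - 1 = -2 by norm_num, rpow_neg hx'.le, rpow_two]
    have hFinv : F (c * x ^ (-1 : ℝ)) = F x := by
      simp only [hF, rpow_neg_one]
      congr 1
      field_simp
      ring
    simp only [hpow, hFinv, abs_neg, abs_one, smul_eq_mul]
    ring
  have hsplit : ∫ x in Set.Ioi (0 : ℝ), (1 + c / x ^ 2) * F x =
      (∫ x in Set.Ioi (0 : ℝ), F x) + ∫ x in Set.Ioi (0 : ℝ), c / x ^ 2 * F x := by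
    rw [← integral_add hF_int]
    · simp_rw [add_mul, one_mul]
    · refine (hsum_int.sub hF_int).congr (.of_forall fun x => ?_)
      simp only [Pi.sub_apply]
      ring
  linarith

/-- The Laplace transform of the Lévy (degenerate inverse-Gaussian) density. -/
theorem integral_levy_density_mul_exp {c : ℝ} (hc : 0 < c) :
    ∫ v in Set.Ioi (0 : ℝ), ((2 * π) ^ (-(1 : ℝ) / 2) * v ^ (-(3 : ℝ) / 2) * exp (-1 / (2 * v))) *
      exp (-(v / 2) * c ^ 2) = exp (-c) := by
  rw [← integral_comp_rpow_Ioi _ (p := -2) (by norm_num)]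
  have hconst : (2 * π) ^ (-(1 : ℝ) / 2) = (√(2 * π))⁻¹ := by
    rw [neg_div, rpow_neg (by positivity), sqrt_eq_rpow]
  have hpt : ∀ x ∈ Set.Ioi (0 : ℝ), (|(-2 : ℝ)| * x ^ ((-2 : ℝ) - 1)) •
      (((2 * π) ^ (-(1 : ℝ) / 2) * (x ^ (-2 : ℝ)) ^ (-(3 : ℝ) / 2) *
        exp (-1 / (2 * x ^ (-2 : ℝ)))) * exp (-(x ^ (-2 : ℝ) / 2) * c ^ 2)) =
      2 * (√(2 * π))⁻¹ * exp (-c) * exp (-(1 / 2) * (x - c / x) ^ 2) := by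
    intro x hx
    have hx' : 0 < x := hx
    have hpow : x ^ ((-2 : ℝ) - 1) * (x ^ (-2 : ℝ)) ^ (-(3 : ℝ) / 2) = 1 := by
      rw [← rpow_mul hx'.le, ← rpow_add hx']
      norm_num
    have hsq : x ^ (-2 : ℝ) = (x ^ 2)⁻¹ := by
      rw [rpow_neg hx'.le, rpow_two]
    have hexp : exp (-1 / (2 * x ^ (-2 : ℝ))) * exp (-(x ^ (-2 : ℝ) / 2) * c ^ 2) =
        exp (-c) * exp (-(1 / 2) * (x - c / x) ^ 2) := by
      rw [← exp_add, ← exp_add, hsq]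
      congr 1
      field_simp
      ring
    rw [hconst, smul_eq_mul, abs_neg, abs_two]
    linear_combination (2 * (√(2 * π))⁻¹ * exp (-1 / (2 * x ^ (-2 : ℝ))) *
      exp (-(x ^ (-2 : ℝ) / 2) * c ^ 2)) * hpow + 2 * (√(2 * π))⁻¹ * hexp
  rw [setIntegral_congr_fun measurableSet_Ioi hpt, integral_const_mul,
    integral_exp_neg_half_sub_div_sq hc]
  have : √(2 * π) ≠ 0 := by positivity
  field_simp

theorem gamma_invGauss_augmentation (n : ℝ) (hn : 0 < n) (y : ℕ) (hy : 1 ≤ y) (β : ℝ) :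
    (-β + Real.sqrt (β ^ 2 + 4)) ^ (-(y : ℤ)) *
        Real.exp (-(n / 2) * (β + Real.sqrt (β ^ 2 + 4))) =
      ∫ u in Set.Ioi (0 : ℝ), ∫ v in Set.Ioi (0 : ℝ),
        (u ^ (y - 1) / Real.Gamma y) * Real.exp (-(n / 2 - u) * β) *
          ((2 * π) ^ (-(1 : ℝ) / 2) * v ^ (-(3 : ℝ) / 2) * Real.exp (-1 / (2 * v))) *
          Real.exp (-(v / 2) * (n / 2 + u) ^ 2 * (β ^ 2 + 4)) := by
  set s := √(β ^ 2 + 4) with hs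
  have hs2 : s ^ 2 = β ^ 2 + 4 := sq_sqrt (by positivity)
  have hspos : 0 < s := sqrt_pos.2 (by positivity)
  have hr : 0 < -β + s := by
    have : β < s := lt_sqrt_of_sq_lt (by linarith)
    linarith
  have hΓ : 0 < Gamma (y : ℝ) := Gamma_pos_of_pos (by exact_mod_cast hy)
  have hinner : ∀ u ∈ Set.Ioi (0 : ℝ), (∫ v in Set.Ioi (0 : ℝ),
        (u ^ (y - 1) / Real.Gamma y) * Real.exp (-(n / 2 - u) * β) *
          ((2 * π) ^ (-(1 : ℝ) / 2) * v ^ (-(3 : ℝ) / 2) * Real.exp (-1 / (2 * v))) *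
          Real.exp (-(v / 2) * (n / 2 + u) ^ 2 * (β ^ 2 + 4))) =
      exp (-(n / 2) * (β + s)) / Gamma y * (u ^ ((y : ℝ) - 1) * exp (-((-β + s) * u))) := by
    intro u hu
    have hu' : 0 < u := hu
    simp_rw [← hs2, mul_assoc (-(_ / 2)) ((n / 2 + u) ^ 2), ← mul_pow,
      mul_assoc (u ^ (y - 1) / Gamma y * exp (-(n / 2 - u) * β))]
    rw [integral_const_mul, integral_levy_density_mul_exp (by positivity),
      show (y : ℝ) - 1 = ((y - 1 : ℕ) : ℝ) by push_cast [hy]; rfl, rpow_natCast]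
    have hexp : exp (-(n / 2 - u) * β) * exp (-((n / 2 + u) * s)) =
        exp (-(n / 2) * (β + s)) * exp (-((-β + s) * u)) := by
      rw [← exp_add, ← exp_add]
      congr 1
      ring
    linear_combination u ^ (y - 1) / Gamma y * hexp
  rw [setIntegral_congr_fun measurableSet_Ioi hinner, integral_const_mul,
    integral_rpow_mul_exp_neg_mul_Ioi (by exact_mod_cast hy) hr, rpow_natCast, one_div, inv_pow,
    zpow_neg, zpow_natCast]
  field_simp
end

section
/- Let Ψ be a real symmetric positive definite p×p matrix and let A be a real symmetric positive semidefinite p×p matrix. Then (Ψ + A)⁻¹ Ψ (Ψ + A)⁻¹ = (Ψ + 2A + AΨ⁻¹A)⁻¹, and in the Loewner order (Ψ + 2A + AΨ⁻¹A)⁻¹ ≤ (Ψ + AΨ⁻¹A)⁻¹; consequently, for every ξ ∈ ℝᵖ, ξᵀ(Ψ + A)⁻¹Ψ(Ψ + A)⁻¹ξ ≤ ξᵀ(Ψ + AΨ⁻¹A)⁻¹ξ. -/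
open Matrix

theorem Matrix.add_mul_inv_mul_add {n R : Type*} [Fintype n] [DecidableEq n] [CommRing R]
    {B : Matrix n n R} (hB : IsUnit B) (D : Matrix n n R) :
    (B + D) * B⁻¹ * (B + D) = B + 2 • D + D * B⁻¹ * D := by
  have hdet := (isUnit_iff_isUnit_det B).mp hB
  simp only [add_mul, mul_add, mul_nonsing_inv B hdet, Matrix.mul_assoc D,
    nonsing_inv_mul B hdet, Matrix.one_mul, Matrix.mul_one]
  abel

/-- Inversion is antitone for the Loewner order on positive definite matrices. -/
theorem Matrix.PosDef.posSemidef_inv_sub_inv_add {n : Type*} [Fintype n] [DecidableEq n]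
    {B D : Matrix n n ℝ} (hB : B.PosDef) (hD : D.PosSemidef) :
    (B⁻¹ - (B + D)⁻¹).PosSemidef := by
  have hC : (B + D).PosDef := hB.add_posSemidef hD
  have hdet := (isUnit_iff_isUnit_det (B + D)).mp hC.isUnit
  have hDBD : (D * B⁻¹ * D).PosSemidef := by
    simpa only [hD.isHermitian.eq] using hB.inv.posSemidef.conjTranspose_mul_mul_same D
  have hmiddle : D + D * B⁻¹ * D = (B + D) * B⁻¹ * (B + D) - (B + D) := by
    rw [add_mul_inv_mul_add hB.isUnit D]
    abel
  have hfactor : B⁻¹ - (B + D)⁻¹ = (B + D)⁻¹ * (D + D * B⁻¹ * D) * (B + D)⁻¹ := by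
    rw [hmiddle, Matrix.mul_sub, Matrix.sub_mul, nonsing_inv_mul _ hdet, Matrix.one_mul,
      Matrix.mul_assoc (B + D) B⁻¹, nonsing_inv_mul_cancel_left _ _ hdet,
      mul_nonsing_inv_cancel_right _ _ hdet]
  rw [hfactor]
  simpa only [hC.inv.isHermitian.eq] using (hD.add hDBD).conjTranspose_mul_mul_same (B + D)⁻¹

theorem posterior_mean_quadratic_bound {p : ℕ}
    (Ψ A : Matrix (Fin p) (Fin p) ℝ)
    (hΨ : Ψ.PosDef) (hA : A.PosSemidef) :
    (Ψ + A)⁻¹ * Ψ * (Ψ + A)⁻¹ = (Ψ + 2 • A + A * Ψ⁻¹ * A)⁻¹ ∧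
    ((Ψ + A * Ψ⁻¹ * A)⁻¹ - (Ψ + 2 • A + A * Ψ⁻¹ * A)⁻¹).PosSemidef ∧
    ∀ ξ : Fin p → ℝ,
      ξ ⬝ᵥ ((Ψ + A)⁻¹ * Ψ * (Ψ + A)⁻¹) *ᵥ ξ ≤ ξ ⬝ᵥ (Ψ + A * Ψ⁻¹ * A)⁻¹ *ᵥ ξ := by
  have hfactor : (Ψ + A)⁻¹ * Ψ * (Ψ + A)⁻¹ = (Ψ + 2 • A + A * Ψ⁻¹ * A)⁻¹ := by
    rw [← add_mul_inv_mul_add hΨ.isUnit A, Matrix.mul_inv_rev, Matrix.mul_inv_rev,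
      nonsing_inv_nonsing_inv _ ((isUnit_iff_isUnit_det Ψ).mp hΨ.isUnit), Matrix.mul_assoc]
  have hAΨA : (A * Ψ⁻¹ * A).PosSemidef := by
    simpa only [hA.isHermitian.eq] using hΨ.inv.posSemidef.conjTranspose_mul_mul_same A
  have hle : ((Ψ + A * Ψ⁻¹ * A)⁻¹ - (Ψ + 2 • A + A * Ψ⁻¹ * A)⁻¹).PosSemidef := by
    have h2A : (2 • A).PosSemidef := two_nsmul A ▸ hA.add hA
    rw [add_right_comm Ψ]
    exact (hΨ.add_posSemidef hAΨA).posSemidef_inv_sub_inv_add h2A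
  refine ⟨hfactor, hle, fun ξ => ?_⟩
  have hξ := hle.dotProduct_mulVec_nonneg ξ
  rw [star_trivial, sub_mulVec, dotProduct_sub] at hξ
  rw [hfactor]
  exact sub_nonneg.mp hξ
end

section
/- Let Ψ be a real symmetric positive definite p×p matrix, A a real symmetric invertible p×p matrix, and c > 0 such that AΨ⁻¹A ≤ cΨ in the Loewner order. Then for every β ∈ ℝᵖ, βᵀ(Ψ⁻¹ + A⁻¹ΨA⁻¹)⁻¹β ≤ (c/(1 + c)) · βᵀΨβ ≤ βᵀΨβ. -/
open Matrix

/-- For positive definite matrices, `A⁻¹ ≤ D` in the Loewner order if and only if `D⁻¹ ≤ A`. -/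
theorem Matrix.PosDef.posSemidef_sub_inv_iff {n : Type*} [Fintype n] [DecidableEq n]
    {A D : Matrix n n ℝ} (hA : A.PosDef) (hD : D.PosDef) :
    (D - A⁻¹).PosSemidef ↔ (A - D⁻¹).PosSemidef := by
  let _ : Invertible A := hA.isUnit.invertible
  let _ : Invertible D := hD.isUnit.invertible
  have h₁ := hA.fromBlocks₁₁ (1 : Matrix n n ℝ) D
  have h₂ := PosDef.fromBlocks₂₂ A (1 : Matrix n n ℝ) hD
  simp only [conjTranspose_one, Matrix.one_mul, Matrix.mul_one] at h₁ h₂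
  exact h₁.symm.trans h₂

theorem K1_quadratic_bound {p : ℕ}
    (Ψ A : Matrix (Fin p) (Fin p) ℝ)
    (hΨ : Ψ.PosDef) (hAsym : A.IsHermitian) (hA : IsUnit A.det)
    (c : ℝ) (hc : 0 < c) (hAc : (c • Ψ - A * Ψ⁻¹ * A).PosSemidef) :
    ∀ β : Fin p → ℝ,
      β ⬝ᵥ (Ψ⁻¹ + A⁻¹ * Ψ * A⁻¹)⁻¹ *ᵥ β ≤ (c / (1 + c)) * (β ⬝ᵥ Ψ *ᵥ β) ∧
      (c / (1 + c)) * (β ⬝ᵥ Ψ *ᵥ β) ≤ β ⬝ᵥ Ψ *ᵥ β := by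
  have hc1 : 0 < 1 + c := by positivity
  have hk : 0 < c / (1 + c) := by positivity
  have hAinv : (A⁻¹)ᴴ = A⁻¹ := hAsym.inv
  have hS : (Ψ⁻¹ + A⁻¹ * Ψ * A⁻¹).PosDef := by
    have h := hΨ.posSemidef.conjTranspose_mul_mul_same A⁻¹
    rw [hAinv] at h
    exact hΨ.inv.add_posSemidef h
  have hlower : (Ψ⁻¹ + A⁻¹ * Ψ * A⁻¹ - ((c / (1 + c)) • Ψ)⁻¹).PosSemidef := by
    have h := (hAc.conjTranspose_mul_mul_same A⁻¹).smul (inv_nonneg.mpr hc.le)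
    have hconj : A⁻¹ * (A * Ψ⁻¹ * A) * A⁻¹ = Ψ⁻¹ := by
      rw [Matrix.mul_assoc A, nonsing_inv_mul_cancel_left _ _ hA,
        mul_nonsing_inv_cancel_right _ _ hA]
    have hsmul : ((c / (1 + c)) • Ψ)⁻¹ = (1 + c⁻¹) • Ψ⁻¹ := by
      refine inv_eq_right_inv ?_
      rw [smul_mul_smul_comm, mul_nonsing_inv _ ((isUnit_iff_isUnit_det _).mp hΨ.isUnit)]
      convert one_smul ℝ (1 : Matrix (Fin p) (Fin p) ℝ) using 2
      field_simp
      ring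
    rw [hAinv, Matrix.mul_sub, Matrix.sub_mul, hconj, Matrix.mul_smul, Matrix.smul_mul,
      smul_sub, inv_smul_smul₀ hc.ne'] at h
    rw [hsmul, add_smul, one_smul, add_sub_add_left_eq_sub]
    exact h
  have hupper := ((hΨ.smul hk).posSemidef_sub_inv_iff hS).mp hlower
  intro β
  constructor
  · have h := hupper.dotProduct_mulVec_nonneg β
    rw [star_trivial, sub_mulVec, dotProduct_sub, smul_mulVec, dotProduct_smul, smul_eq_mul] at h
    exact sub_nonneg.mp h
  · have h := hΨ.posSemidef.dotProduct_mulVec_nonneg β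
    rw [star_trivial] at h
    exact mul_le_of_le_one_left h ((div_le_one hc1).mpr (by linarith))
end

section
/- Let q ≥ 1 and m ≥ 1 be integers, let y₁,…,y_q be integers with y_k ≥ 1, and let β₁,…,β_q ∈ ℝ. Set b_k = −β_k + √(β_k² + 4) and Λ = Σ_{k=1}^q (β_k + √(β_k² + 4))/2. Then (2 + 2Λ)^{−m} · ∏_{k=1}^q b_k^{−y_k} = ∫_{(0,∞)^{1+q}} (u₀^{m−1} e^{−2u₀}/Γ(m)) · ∏_{k=1}^q (u_k^{y_k−1}/Γ(y_k)) · ∏_{k=1}^q [exp(β_k(u_k − u₀)) · exp(−(u_k + u₀)√(β_k² + 4))] d(u₀, u₁, …, u_q). -/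
open MeasureTheory Real

lemma integral_gamma_kernel_Ioi {n : ℕ} (hn : 1 ≤ n) {r : ℝ} (hr : 0 < r) :
    ∫ t in Set.Ioi (0 : ℝ), t ^ (n - 1) / Real.Gamma n * Real.exp (-(r * t)) =
      r ^ (-(n : ℤ)) := by
  have hn' : (0 : ℝ) < n := by exact_mod_cast hn
  have h := Real.integral_rpow_mul_exp_neg_mul_Ioi hn' hr
  have hG : Real.Gamma n ≠ 0 := (Real.Gamma_pos_of_pos hn').ne'
  have hpow (t : ℝ) : t ^ ((n : ℝ) - 1) = t ^ (n - 1) := by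
    rw [← Real.rpow_natCast, Nat.cast_sub hn, Nat.cast_one]
  simp_rw [hpow] at h
  simp_rw [div_mul_eq_mul_div]
  rw [integral_div, h, mul_div_cancel_right₀ _ hG, Real.rpow_natCast, one_div, inv_pow,
    zpow_neg, zpow_natCast]

lemma abs_lt_sqrt_sq_add_four (x : ℝ) : |x| < Real.sqrt (x ^ 2 + 4) := by
  rw [← Real.sqrt_sq_eq_abs]
  exact Real.sqrt_lt_sqrt (sq_nonneg x) (by linarith)

theorem multinomial_gamma_augmentation (q m : ℕ) (hq : 1 ≤ q) (hm : 1 ≤ m)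
    (y : Fin q → ℕ) (hy : ∀ k, 1 ≤ y k) (β : Fin q → ℝ)
    (b : Fin q → ℝ) (hb : ∀ k, b k = -β k + Real.sqrt (β k ^ 2 + 4))
    (Λ : ℝ) (hΛ : Λ = ∑ k, (β k + Real.sqrt (β k ^ 2 + 4)) / 2) :
    (2 + 2 * Λ) ^ (-(m : ℤ)) * ∏ k, b k ^ (-(y k : ℤ)) =
      ∫ u in Set.univ.pi (fun _ : Fin (q + 1) => Set.Ioi (0 : ℝ)),
        (u 0 ^ (m - 1) * Real.exp (-2 * u 0) / Real.Gamma m) *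
          (∏ k : Fin q, u k.succ ^ (y k - 1) / Real.Gamma (y k)) *
          ∏ k : Fin q,
            Real.exp (β k * (u k.succ - u 0)) *
              Real.exp (-(u k.succ + u 0) * Real.sqrt (β k ^ 2 + 4)) := by
  have hb_pos (k : Fin q) : 0 < b k := by
    rw [hb]
    linarith [(abs_lt.mp (abs_lt_sqrt_sq_add_four (β k))).2]
  have hΛ_nonneg : 0 ≤ Λ := by
    rw [hΛ]
    exact Finset.sum_nonneg fun k _ => by
      linarith [(abs_lt.mp (abs_lt_sqrt_sq_add_four (β k))).1]
  let n : Fin (q + 1) → ℕ := Fin.cons m y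
  let r : Fin (q + 1) → ℝ := Fin.cons (2 + 2 * Λ) b
  have hfactor (u : Fin (q + 1) → ℝ) :
      (u 0 ^ (m - 1) * Real.exp (-2 * u 0) / Real.Gamma m) *
          (∏ k : Fin q, u k.succ ^ (y k - 1) / Real.Gamma (y k)) *
          ∏ k : Fin q,
            Real.exp (β k * (u k.succ - u 0)) *
              Real.exp (-(u k.succ + u 0) * Real.sqrt (β k ^ 2 + 4)) =
        ∏ i, u i ^ (n i - 1) / Real.Gamma (n i) * Real.exp (-(r i * u i)) := by
    have hexp (k : Fin q) :
        Real.exp (β k * (u k.succ - u 0)) *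
            Real.exp (-(u k.succ + u 0) * Real.sqrt (β k ^ 2 + 4)) =
          Real.exp (-((β k + Real.sqrt (β k ^ 2 + 4)) / 2 * (2 * u 0))) *
            Real.exp (-(b k * u k.succ)) := by
      rw [← Real.exp_add, ← Real.exp_add, hb]
      ring_nf
    have hexp_zero : Real.exp (-((2 + 2 * Λ) * u 0)) =
        Real.exp (-2 * u 0) *
          ∏ k, Real.exp (-((β k + Real.sqrt (β k ^ 2 + 4)) / 2 * (2 * u 0))) := by
      rw [← Real.exp_sum, Finset.sum_neg_distrib, ← Finset.sum_mul, ← hΛ, ← Real.exp_add]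
      ring_nf
    simp only [Fin.prod_univ_succ, n, r, Fin.cons_zero, Fin.cons_succ, hexp, hexp_zero,
      Finset.prod_mul_distrib]
    ring
  have hrpos (i : Fin (q + 1)) : 0 < r i := by
    refine Fin.cases ?_ (fun k => ?_) i
    · simp only [r, Fin.cons_zero]
      linarith
    · simpa only [r, Fin.cons_succ] using hb_pos k
  have hn (i : Fin (q + 1)) : 1 ≤ n i := Fin.cases hm hy i
  simp_rw [hfactor]
  rw [volume_pi, Measure.restrict_pi_pi, integral_fintype_prod_eq_prod
    (f := fun i t => t ^ (n i - 1) / Real.Gamma (n i) * Real.exp (-(r i * t)))]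
  simp_rw [fun i => integral_gamma_kernel_Ioi (hn i) (hrpos i)]
  simp only [Fin.prod_univ_succ, n, r, Fin.cons_zero, Fin.cons_succ]
end
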